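/- Let K ≥ 1 and let w : D → [0,+∞) be a function whose upper semicontinuous regularization w*(x) := limsup_{y→x} w(y) is locally bounded in D. If for every closed ball B̄ⁿ(x,r) ⊂ D one has w(x) ≤ (K/(ν_n rⁿ)) ∫_{Bⁿ(x,r)} w*(y) dm_n(y), then for every closed ball B̄ⁿ(x,r) ⊂ D one also has w*(x) ≤ (K/(ν_n rⁿ)) ∫_{Bⁿ(x,r)} w*(y) dm_n(y). -/

import Mathlib

open MeasureTheory Metric Filter Set ENNReal

noncomputable section

/-- The positive part of an extended real number, as an element of `ℝ≥0∞`. -/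
def erealPos (x : EReal) : ℝ≥0∞ := if x = ⊤ then ⊤ else ENNReal.ofReal x.toReal

/-- `ν_n`, the Lebesgue measure of the unit ball of `ℝⁿ`. -/
def nuBall (n : ℕ) : ℝ := (volume (Metric.ball (0 : EuclideanSpace ℝ (Fin n)) 1)).toReal

/-- The (upper) integral `∫_A u dm_n` of an `EReal`-valued function, defined as the
lintegral of the positive part minus the lintegral of the negative part (an `EReal`). -/
def erealIntegralOn {n : ℕ} (A : Set (EuclideanSpace ℝ (Fin n)))
    (u : EuclideanSpace ℝ (Fin n) → EReal) : EReal :=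
  ((∫⁻ y in A, erealPos (u y) : ℝ≥0∞) : EReal) - ((∫⁻ y in A, erealPos (-(u y)) : ℝ≥0∞) : EReal)

/-- `u⁺ ∈ L¹_loc(D)`: the positive part of `u` has finite integral over every
compact subset of `D`. -/
def PosPartLocInt {n : ℕ} (u : EuclideanSpace ℝ (Fin n) → EReal)
    (D : Set (EuclideanSpace ℝ (Fin n))) : Prop :=
  ∀ E ⊆ D, IsCompact E → ∫⁻ x in E, erealPos (u x) < ⊤

/-- `u : D → [-∞, +∞)` is subharmonic on `D`: upper semicontinuous on `D`, never `+∞` on `D`,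
and satisfying the sub-mean-value inequality on every closed ball contained in `D`.
(The function `≡ -∞` satisfies this definition.) -/
def SubharmonicOn {n : ℕ} (u : EuclideanSpace ℝ (Fin n) → EReal)
    (D : Set (EuclideanSpace ℝ (Fin n))) : Prop :=
  UpperSemicontinuousOn u D ∧ (∀ x ∈ D, u x < ⊤) ∧
  ∀ x r, 0 < r → closedBall x r ⊆ D →
    u x ≤ ((1 / (nuBall n * r ^ n) : ℝ) : EReal) * erealIntegralOn (ball x r) u

/-- `u : D → [-∞, +∞)` is nearly subharmonic on `D`. -/
def NearlySubharmonicOn {n : ℕ} (u : EuclideanSpace ℝ (Fin n) → EReal)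
    (D : Set (EuclideanSpace ℝ (Fin n))) : Prop :=
  Measurable (D.restrict u) ∧ (∀ x ∈ D, u x < ⊤) ∧ PosPartLocInt u D ∧
  ∀ x r, 0 < r → closedBall x r ⊆ D →
    u x ≤ ((1 / (nuBall n * r ^ n) : ℝ) : EReal) * erealIntegralOn (ball x r) u

/-- `u : D → [-∞, +∞)` is `K`-quasinearly subharmonic on `D`:
Lebesgue measurable, `u⁺ ∈ L¹_loc(D)`, and for every `M ≥ 0` the function
`u_M := max {u, -M} + M` satisfies the generalized sub-mean-value inequality with constant `K`
on every closed ball contained in `D`. -/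
def QNSubharmonicOn {n : ℕ} (K : ℝ) (u : EuclideanSpace ℝ (Fin n) → EReal)
    (D : Set (EuclideanSpace ℝ (Fin n))) : Prop :=
  Measurable (D.restrict u) ∧ (∀ x ∈ D, u x < ⊤) ∧ PosPartLocInt u D ∧
  ∀ M : ℝ, 0 ≤ M → ∀ x r, 0 < r → closedBall x r ⊆ D →
    erealPos ((u x ⊔ ((-M : ℝ) : EReal)) + ((M : ℝ) : EReal)) ≤
      ENNReal.ofReal (K / (nuBall n * r ^ n)) *
        ∫⁻ y in ball x r, erealPos ((u y ⊔ ((-M : ℝ) : EReal)) + ((M : ℝ) : EReal))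

/-- `u : D → [-∞, +∞)` is `K`-quasinearly subharmonic n.s. (in the narrow sense) on `D`. -/
def QNSubharmonicNSOn {n : ℕ} (K : ℝ) (u : EuclideanSpace ℝ (Fin n) → EReal)
    (D : Set (EuclideanSpace ℝ (Fin n))) : Prop :=
  Measurable (D.restrict u) ∧ (∀ x ∈ D, u x < ⊤) ∧ PosPartLocInt u D ∧
  ∀ x r, 0 < r → closedBall x r ⊆ D →
    u x ≤ ((K / (nuBall n * r ^ n) : ℝ) : EReal) * erealIntegralOn (ball x r) u

/-- `log⁺` on `[0, +∞]`. -/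
def logPlusE (t : ℝ≥0∞) : ℝ≥0∞ := if t = ⊤ then ⊤ else ENNReal.ofReal (Real.log t.toReal)

theorem erealPos_eq_toENNReal (x : EReal) : erealPos x = x.toENNReal := rfl

theorem erealPos_le_of_le_coe {x : EReal} {c : ℝ≥0∞} (h : x ≤ (c : EReal)) : erealPos x ≤ c := by
  rw [erealPos_eq_toENNReal, ← EReal.toENNReal_coe (x := c)]
  exact EReal.toENNReal_le_toENNReal h

theorem nuBall_pos (n : ℕ) : 0 < nuBall n :=
  ENNReal.toReal_pos (measure_ball_pos _ _ one_pos).ne' measure_ball_lt_top.ne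

theorem tendsto_ofReal_div_nuBall_mul (n : ℕ) {K r : ℝ} (hK : 0 < K) (hr : 0 < r) (I : ℝ≥0∞) :
    Tendsto (fun s : ℝ => ENNReal.ofReal (K / (nuBall n * s ^ n)) * I) (nhdsWithin r (Iio r))
      (nhds (ENNReal.ofReal (K / (nuBall n * r ^ n)) * I)) := by
  have hden : 0 < nuBall n * r ^ n := mul_pos (nuBall_pos n) (pow_pos hr n)
  have hcont : ContinuousAt (fun s : ℝ => K / (nuBall n * s ^ n)) r :=
    continuousAt_const.div (by fun_prop) hden.ne'
  refine ENNReal.Tendsto.mul_const (ENNReal.tendsto_ofReal (hcont.tendsto.mono_left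
    nhdsWithin_le_nhds)) (Or.inl ?_)
  exact (ENNReal.ofReal_pos.2 (div_pos hK hden)).ne'

theorem regularization_mean_value_inequality
    (n : ℕ) (hn : 2 ≤ n)
    (D : Set (EuclideanSpace ℝ (Fin n))) (hDopen : IsOpen D) (hDconn : IsConnected D)
    (K : ℝ) (hK : 1 ≤ K)
    (w : EuclideanSpace ℝ (Fin n) → ℝ) (hw0 : ∀ x ∈ D, 0 ≤ w x)
    (wstar : EuclideanSpace ℝ (Fin n) → EReal)
    (hwstar : ∀ y, wstar y = Filter.limsup (fun z => ((w z : ℝ) : EReal)) (nhdsWithin y D))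
    (hloc : ∀ x ∈ D, ∃ r > (0 : ℝ), ∃ C : ℝ, ∀ y ∈ ball x r ∩ D, wstar y ≤ (C : EReal))
    (h : ∀ x r, 0 < r → closedBall x r ⊆ D →
      ENNReal.ofReal (w x) ≤ ENNReal.ofReal (K / (nuBall n * r ^ n)) *
        ∫⁻ y in ball x r, erealPos (wstar y)) :
    ∀ x r, 0 < r → closedBall x r ⊆ D →
      erealPos (wstar x) ≤ ENNReal.ofReal (K / (nuBall n * r ^ n)) *
        ∫⁻ y in ball x r, erealPos (wstar y) := by
  intro x r hr hball
  have hKpos : 0 < K := zero_lt_one.trans_le hK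
  refine ge_of_tendsto (tendsto_ofReal_div_nuBall_mul n hKpos hr _) ?_
  filter_upwards [Ioo_mem_nhdsLT hr] with s hs
  refine erealPos_le_of_le_coe ?_
  rw [hwstar]
  refine Filter.limsup_le_of_le (by isBoundedDefault) ?_
  filter_upwards [mem_nhdsWithin_of_mem_nhds (ball_mem_nhds x (sub_pos.2 hs.2))] with y hy
  have hdist : s + dist y x ≤ r := by linarith [mem_ball.1 hy]
  have hmean := (h y s hs.1 ((closedBall_subset_closedBall' hdist).trans hball)).trans
    (mul_le_mul_right (lintegral_mono_set (ball_subset_ball' hdist)) _)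
  refine le_trans ?_ (EReal.coe_ennreal_le_coe_ennreal_iff.2 hmean)
  rw [EReal.coe_ennreal_ofReal]
  exact EReal.coe_le_coe_iff.2 (le_max_left _ _)
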